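/- Let K be algebraically closed (of characteristic zero), d ≥ 3, and f ∈ ℛ_d with ann_R(f)_1 = 0. Then f has a regular splitting of length ≥ 2 or a degenerate splitting (i.e., there exist n ≥ 1 and f_t ∈ ℛ_d ⊗_K K[t_1,…,t_n] with f_0 = f such that f_t splits regularly at least once over K(t_1,…,t_n)) if and only if β_{1d}(f) > 0, i.e., the ideal ann_R f has at least one minimal generator in degree d (equivalently ann_R(f)_d ≠ R_1·ann_R(f)_{d−1}). -/

import Mathlib

open MvPolynomial

namespace Kleppe

noncomputable section

open scoped Classical

variable {K : Type*}

/-- The iterated partial-derivative operator `∂^β` applied to `f`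
(in the standard polynomial ring; char 0 identification of divided powers). -/
def derivMulti [CommSemiring K] {r : ℕ} (β : Fin r →₀ ℕ) (f : MvPolynomial (Fin r) K) :
    MvPolynomial (Fin r) K :=
  ∑ α ∈ f.support,
    if β ≤ α then
      MvPolynomial.monomial (α - β)
        ((∏ i : Fin r, (α i).descFactorial (β i)) • MvPolynomial.coeff α f)
    else 0

/-- The apolarity action `D(f)` of a differential operator `D ∈ R = K[∂_1,…,∂_r]`
on a polynomial `f ∈ ℛ = K[x_1,…,x_r]`; `∂_i` acts as `∂/∂x_i`. -/
def contract [CommSemiring K] {r : ℕ} (D f : MvPolynomial (Fin r) K) :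
    MvPolynomial (Fin r) K :=
  ∑ β ∈ D.support, MvPolynomial.coeff β D • derivMulti β f

/-- `(A∂)_i = Σ_k A_{ik} ∂_k`, as an element of `R`. -/
def rowOp [CommSemiring K] {r : ℕ} (A : Matrix (Fin r) (Fin r) K) (i : Fin r) :
    MvPolynomial (Fin r) K :=
  ∑ k : Fin r, A i k • X k

/-- The matrix space `M_f = {A | ∂_i·(A∂)_j − ∂_j·(A∂)_i ∈ ann_R f for all i,j}`. -/
def Mf [CommRing K] {r : ℕ} (f : MvPolynomial (Fin r) K) :
    Set (Matrix (Fin r) (Fin r) K) :=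
  {A | ∀ i j : Fin r, contract (X i * rowOp A j - X j * rowOp A i) f = 0}

/-- `γ_f(A)`: the unique homogeneous `g` of degree `d` with `∂_i g = (A∂)_i (f)` for all `i`
(defined by choice; junk value `0` if no such `g` exists). -/
def gammaf [CommRing K] {r : ℕ} (d : ℕ) (f : MvPolynomial (Fin r) K)
    (A : Matrix (Fin r) (Fin r) K) : MvPolynomial (Fin r) K :=
  if h : ∃ g : MvPolynomial (Fin r) K, g.IsHomogeneous d ∧
      ∀ i, contract (X i) g = contract (rowOp A i) f then h.choose else 0

/-- `R_e(g)`, the space of contractions of `g` by homogeneous operators of degree `e`. -/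
def partials [CommRing K] {r : ℕ} (e : ℕ) (g : MvPolynomial (Fin r) K) :
    Submodule K (MvPolynomial (Fin r) K) :=
  Submodule.span K {p | ∃ D : MvPolynomial (Fin r) K, D.IsHomogeneous e ∧ p = contract D g}

/-- `G` is (the set of components of) a regular splitting of `f`:
`f = Σ_{g ∈ G} g`, each `g` a nonzero degree-`d` form, and the spaces of
`(d−1)`-st partials `R_{d−1}(g)` are independent. -/
def IsRegSplit [CommRing K] {r : ℕ} (d : ℕ) (f : MvPolynomial (Fin r) K)
    (G : Set (MvPolynomial (Fin r) K)) : Prop :=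
  G.Finite ∧ G.Nonempty ∧ (∀ g ∈ G, g ≠ 0 ∧ g.IsHomogeneous d) ∧ (∑ᶠ g ∈ G, g) = f ∧
  ∀ g ∈ G, Disjoint (partials (d - 1) g) (⨆ h ∈ G \ {g}, partials (d - 1) h)

/-- A complete set of orthogonal idempotents in `M_f`. -/
def IsCoid [CommRing K] {r : ℕ} (f : MvPolynomial (Fin r) K)
    (E : Set (Matrix (Fin r) (Fin r) K)) : Prop :=
  E.Finite ∧ E ⊆ Mf f ∧ (∀ A ∈ E, A ≠ 0) ∧
  (∀ A ∈ E, ∀ B ∈ E, A ≠ B → A * B = 0) ∧ (∑ᶠ A ∈ E, A) = 1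

end

section Basics

variable {K : Type*} {r : ℕ}

lemma coeff_derivMulti [CommSemiring K] (β γ : Fin r →₀ ℕ) (f : MvPolynomial (Fin r) K) :
    coeff γ (derivMulti β f) =
      (∏ i : Fin r, ((β + γ) i).descFactorial (β i)) • coeff (β + γ) f := by
  classical
  unfold derivMulti
  rw [coeff_sum, Finset.sum_eq_single (β + γ)]
  · rw [if_pos (by simp), coeff_monomial, if_pos (by simp)]
  · intro b _ hb
    split_ifs with h
    · rw [coeff_monomial, if_neg]
      intro h2
      apply hb
      rw [← h2]
      exact (add_tsub_cancel_of_le h).symm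
    · simp
  · intro h
    rw [notMem_support_iff] at h
    simp [h]

lemma contract_eq_sum [CommSemiring K] (D f : MvPolynomial (Fin r) K)
    (s : Finset (Fin r →₀ ℕ)) (hs : D.support ⊆ s) :
    contract D f = ∑ β ∈ s, coeff β D • derivMulti β f := by
  unfold contract
  apply Finset.sum_subset hs
  intro x _ hx
  rw [notMem_support_iff] at hx
  simp [hx]

lemma contract_add_left [CommSemiring K] (D E f : MvPolynomial (Fin r) K) :
    contract (D + E) f = contract D f + contract E f := by
  classical
  rw [contract_eq_sum (D + E) f (D.support ∪ E.support) support_add,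
    contract_eq_sum D f (D.support ∪ E.support) Finset.subset_union_left,
    contract_eq_sum E f (D.support ∪ E.support) Finset.subset_union_right,
    ← Finset.sum_add_distrib]
  simp [add_smul]

lemma contract_smul_left [CommSemiring K] (c : K) (D f : MvPolynomial (Fin r) K) :
    contract (c • D) f = c • contract D f := by
  classical
  rw [contract_eq_sum (c • D) f (D.support) support_smul, contract, Finset.smul_sum]
  simp [mul_smul]

/-- `contract` as a linear map in the operator. -/
noncomputable def contractL [CommSemiring K] (f : MvPolynomial (Fin r) K) :
    MvPolynomial (Fin r) K →ₗ[K] MvPolynomial (Fin r) K where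
  toFun D := contract D f
  map_add' D E := contract_add_left D E f
  map_smul' c D := contract_smul_left c D f

lemma coeff_contract [CommSemiring K] (D f : MvPolynomial (Fin r) K) (γ : Fin r →₀ ℕ) :
    coeff γ (contract D f) = ∑ β ∈ D.support, coeff β D *
      ((∏ i : Fin r, ((β + γ) i).descFactorial (β i)) • coeff (β + γ) f) := by
  unfold contract
  rw [coeff_sum]
  simp only [coeff_smul, coeff_derivMulti, smul_eq_mul]

lemma contract_add_right [CommSemiring K] (D f g : MvPolynomial (Fin r) K) :
    contract D (f + g) = contract D f + contract D g := by
  ext γ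
  simp only [coeff_add, coeff_contract, smul_add, mul_add, Finset.sum_add_distrib]

lemma contract_smul_right [CommSemiring K] (c : K) (D f : MvPolynomial (Fin r) K) :
    contract D (c • f) = c • contract D f := by
  ext γ
  simp only [coeff_smul, coeff_contract, smul_eq_mul, nsmul_eq_mul]
  rw [Finset.mul_sum]
  refine Finset.sum_congr rfl fun _ _ => by ring

/-- `contract` as a linear map in the form. -/
noncomputable def contractR [CommSemiring K] (D : MvPolynomial (Fin r) K) :
    MvPolynomial (Fin r) K →ₗ[K] MvPolynomial (Fin r) K where
  toFun f := contract D f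
  map_add' f g := contract_add_right D f g
  map_smul' c f := contract_smul_right c D f

lemma contract_monomial [CommSemiring K] (β : Fin r →₀ ℕ) (c : K) (f : MvPolynomial (Fin r) K) :
    contract (monomial β c) f = c • derivMulti β f := by
  classical
  rw [contract_eq_sum _ f {β} support_monomial_subset]
  simp

lemma derivMulti_add_single [CommSemiring K] (β : Fin r →₀ ℕ) (i : Fin r)
    (f : MvPolynomial (Fin r) K) :
    derivMulti (β + Finsupp.single i 1) f = pderiv i (derivMulti β f) := by
  classical
  ext γ
  rw [coeff_pderiv, coeff_derivMulti, coeff_derivMulti]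
  have h1 : β + Finsupp.single i 1 + γ = β + (γ + Finsupp.single i 1) := by
    rw [add_assoc, add_comm γ]
  rw [h1]
  have h2 : (∏ j : Fin r, ((β + (γ + Finsupp.single i 1) : Fin r →₀ ℕ) j).descFactorial
      ((β + Finsupp.single i 1 : Fin r →₀ ℕ) j)) =
      (∏ j : Fin r, ((β + (γ + Finsupp.single i 1) : Fin r →₀ ℕ) j).descFactorial (β j)) * (γ i + 1) := by
    rw [← Finset.mul_prod_erase _ _ (Finset.mem_univ i),
      ← Finset.mul_prod_erase (a := i) Finset.univ
        (fun j : Fin r => ((β + (γ + Finsupp.single i 1) : Fin r →₀ ℕ) j).descFactorial (β j))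
        (Finset.mem_univ i)]
    have h3 : ((β + (γ + Finsupp.single i 1) : Fin r →₀ ℕ) i).descFactorial ((β + Finsupp.single i 1 : Fin r →₀ ℕ) i) =
        (γ i + 1) * ((β + (γ + Finsupp.single i 1) : Fin r →₀ ℕ) i).descFactorial (β i) := by
      simp [Nat.descFactorial_succ]
    rw [h3]
    have h4 : ∀ j ∈ (Finset.univ : Finset (Fin r)).erase i, ((β + (γ + Finsupp.single i 1) : Fin r →₀ ℕ) j).descFactorial
      ((β + Finsupp.single i 1 : Fin r →₀ ℕ) j) = ((β + (γ + Finsupp.single i 1) : Fin r →₀ ℕ) j).descFactorial (β j) := by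
      intro j hj
      have : j ≠ i := Finset.ne_of_mem_erase hj
      simp [this.symm]
    rw [Finset.prod_congr rfl h4]
    ring
  rw [h2]
  simp only [nsmul_eq_mul, Nat.cast_mul, Nat.cast_add, Nat.cast_one]
  ring

lemma contract_X_mul [CommSemiring K] (i : Fin r) (D f : MvPolynomial (Fin r) K) :
    contract (X i * D) f = pderiv i (contract D f) := by
  induction D using MvPolynomial.induction_on' with
  | monomial β c =>
    rw [mul_comm, X, monomial_mul, mul_one, contract_monomial, contract_monomial,
      derivMulti_add_single, Derivation.map_smul]
  | add p q hp hq => rw [mul_add, contract_add_left, contract_add_left, hp, hq, map_add]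

lemma contract_C [CommSemiring K] (a : K) (f : MvPolynomial (Fin r) K) :
    contract (C a) f = a • f := by
  rw [C_apply, contract_monomial]
  congr 1
  ext γ
  simp [coeff_derivMulti]

lemma contract_X [CommSemiring K] (i : Fin r) (f : MvPolynomial (Fin r) K) :
    contract (X i) f = pderiv i f := by
  have := contract_X_mul i (C 1) f
  rwa [contract_C, one_smul, C_1, mul_one] at this

lemma pderiv_comm' [CommSemiring K] (i j : Fin r) (f : MvPolynomial (Fin r) K) :
    pderiv i (pderiv j f) = pderiv j (pderiv i f) := by
  rw [← contract_X j f, ← contract_X_mul, mul_comm, contract_X_mul, contract_X]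

lemma contract_pderiv [CommSemiring K] (i : Fin r) (D f : MvPolynomial (Fin r) K) :
    contract D (pderiv i f) = pderiv i (contract D f) := by
  induction D using MvPolynomial.induction_on with
  | C a => rw [contract_C, contract_C, Derivation.map_smul]
  | add p q hp hq => rw [contract_add_left, contract_add_left, hp, hq, map_add]
  | mul_X p j hp => rw [mul_comm, contract_X_mul, contract_X_mul, hp, pderiv_comm']

/-- constant term pairing -/
noncomputable def pr [CommSemiring K] (D f : MvPolynomial (Fin r) K) : K := coeff 0 (contract D f)

lemma pr_eq [CommSemiring K] (D f : MvPolynomial (Fin r) K) :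
    pr D f = ∑ β ∈ D.support, coeff β D * ((∏ i : Fin r, (β i).factorial) • coeff β f) := by
  rw [pr, coeff_contract]
  simp [Nat.descFactorial_self]

lemma pr_comm [CommSemiring K] (D f : MvPolynomial (Fin r) K) : pr D f = pr f D := by
  classical
  have h : ∀ D f : MvPolynomial (Fin r) K, pr D f = ∑ β ∈ D.support ∪ f.support,
      coeff β D * ((∏ i : Fin r, (β i).factorial) • coeff β f) := by
    intro D f
    rw [pr_eq]
    apply Finset.sum_subset Finset.subset_union_left
    intro x _ hx
    rw [notMem_support_iff] at hx
    simp [hx]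
  rw [h, h, Finset.union_comm]
  refine Finset.sum_congr rfl fun β _ => ?_
  simp only [nsmul_eq_mul]
  ring

lemma contract_eq_C [CommSemiring K] {D f : MvPolynomial (Fin r) K} {e : ℕ}
    (hD : D.IsHomogeneous e) (hf : f.IsHomogeneous e) : contract D f = C (pr D f) := by
  classical
  ext γ
  rw [coeff_C]
  split_ifs with h
  · rw [← h, pr]
  · rw [coeff_contract]
    apply Finset.sum_eq_zero
    intro β hβ
    have h1 : β.degree = e := by
      by_contra h1
      exact (mem_support_iff.mp hβ) (hD.coeff_eq_zero h1)
    have h2 : coeff (β + γ) f = 0 := by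
      apply hf.coeff_eq_zero
      have : γ.degree ≠ 0 := by
        rw [Ne, Finsupp.degree_eq_zero_iff]
        exact fun h' => h h'.symm
      rw [map_add]
      omega
    rw [h2]
    simp

lemma contract_eq_zero_iff [CommSemiring K] {D f : MvPolynomial (Fin r) K} {e : ℕ}
    (hD : D.IsHomogeneous e) (hf : f.IsHomogeneous e) : contract D f = 0 ↔ pr D f = 0 := by
  rw [contract_eq_C hD hf, C_eq_zero]

/-- pairing as a linear map -/
noncomputable def prL [CommSemiring K] (f : MvPolynomial (Fin r) K) :
    MvPolynomial (Fin r) K →ₗ[K] K := (lcoeff K 0) ∘ₗ contractL f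

lemma prL_apply [CommSemiring K] (D f : MvPolynomial (Fin r) K) : prL f D = pr D f := rfl

lemma pr_X_mul [CommSemiring K] (i : Fin r) (D f : MvPolynomial (Fin r) K) :
    pr (X i * D) f = pr D (pderiv i f) := by
  rw [pr, pr, contract_X_mul, contract_pderiv]

lemma coeff_single_contract [CommSemiring K] (i : Fin r) (D f : MvPolynomial (Fin r) K) :
    coeff (Finsupp.single i 1) (contract D f) = pr D (pderiv i f) := by
  rw [pr, contract_pderiv, coeff_pderiv]
  simp

lemma contract_isHomogeneous [CommSemiring K] {D f : MvPolynomial (Fin r) K} {a b : ℕ}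
    (hD : D.IsHomogeneous a) (hf : f.IsHomogeneous (a + b)) :
    (contract D f).IsHomogeneous b := by
  intro γ hγ
  by_contra h
  apply hγ
  rw [coeff_contract]
  apply Finset.sum_eq_zero
  intro β hβ
  have h1 : β.degree = a := by
    by_contra h1
    exact (mem_support_iff.mp hβ) (hD.coeff_eq_zero h1)
  have h2 : coeff (β + γ) f = 0 := by
    apply hf.coeff_eq_zero
    rw [map_add, h1]
    intro h3
    apply h
    have : γ.degree = b := by omega
    rw [← this, Finsupp.degree_eq_weight_one]
    rfl
  rw [h2]
  simp

/-- perfectness: nondegenerate -/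
lemma eq_zero_of_pr [Field K] [CharZero K] {f : MvPolynomial (Fin r) K} {e : ℕ}
    (hf : f.IsHomogeneous e)
    (h : ∀ D : MvPolynomial (Fin r) K, D.IsHomogeneous e → pr D f = 0) : f = 0 := by
  classical
  ext γ
  by_cases hγ : γ.degree = e
  · have := h (monomial γ 1) (isHomogeneous_monomial _ hγ)
    rw [pr, contract_monomial, one_smul, coeff_derivMulti] at this
    simp only [add_zero, Nat.descFactorial_self, nsmul_eq_mul, mul_eq_zero, Nat.cast_eq_zero,
      Finset.prod_eq_zero_iff] at this
    rcases this with ⟨i, _, hi⟩ | h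
    · exact absurd hi (Nat.factorial_ne_zero _)
    · simpa using h
  · rw [hf.coeff_eq_zero hγ, coeff_zero]

/-- perfectness: separation -/
lemma exists_pr_separating [Field K] [CharZero K] {e : ℕ} {u : MvPolynomial (Fin r) K}
    (hu : u.IsHomogeneous e) (W : Submodule K (MvPolynomial (Fin r) K))
    (hW : ∀ w ∈ W, w.IsHomogeneous e) (huW : u ∉ W) :
    ∃ v : MvPolynomial (Fin r) K, v.IsHomogeneous e ∧ (∀ w ∈ W, pr w v = 0) ∧ pr u v ≠ 0 := by
  classical
  obtain ⟨φ, h1, h2⟩ := Submodule.exists_le_ker_of_notMem huW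
  let T : Finset (Fin r →₀ ℕ) := Finset.finsuppAntidiag Finset.univ e
  have hT : ∀ β, β ∈ T ↔ β.degree = e := by
    intro β
    simp [T, Finset.mem_finsuppAntidiag, Finsupp.degree_eq_sum]
  let v : MvPolynomial (Fin r) K := ∑ β ∈ T,
    monomial β (φ (monomial β 1) / ((∏ i : Fin r, (β i).factorial : ℕ) : K))
  have hcv : ∀ β ∈ T, coeff β v = φ (monomial β 1) / ((∏ i : Fin r, (β i).factorial : ℕ) : K) := by
    intro β hβ
    simp only [v, coeff_sum, coeff_monomial]
    rw [Finset.sum_ite_eq' T β, if_pos hβ]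
  have hp : ∀ w : MvPolynomial (Fin r) K, w.IsHomogeneous e → pr w v = φ w := by
    intro w hw
    rw [pr_eq]
    conv_rhs => rw [← support_sum_monomial_coeff w, map_sum]
    refine Finset.sum_congr rfl fun β hβ => ?_
    have hβT : β ∈ T := by
      rw [hT]
      by_contra h1
      exact (mem_support_iff.mp hβ) (hw.coeff_eq_zero h1)
    have hne : ((∏ i : Fin r, (β i).factorial : ℕ) : K) ≠ 0 := by
      rw [Nat.cast_ne_zero]
      exact Finset.prod_ne_zero_iff.mpr fun i _ => Nat.factorial_ne_zero _
    rw [hcv β hβT, nsmul_eq_mul, mul_div_cancel₀ _ hne]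
    have : monomial β (coeff β w) = (coeff β w) • (monomial β (1 : K)) := by
      rw [smul_monomial, smul_eq_mul, mul_one]
    rw [this, map_smul, smul_eq_mul]
  refine ⟨v, ?_, ?_, ?_⟩
  · apply IsHomogeneous.sum
    intro β hβ
    exact isHomogeneous_monomial _ ((hT β).mp hβ)
  · intro w hw
    rw [hp w (hW w hw)]
    exact h2 hw
  · rw [hp u hu]
    exact h1

lemma eq_zero_of_pderiv [Field K] [CharZero K] {f : MvPolynomial (Fin r) K} {d : ℕ} (hd : d ≠ 0)
    (hf : f.IsHomogeneous d) (h : ∀ i, pderiv i f = 0) : f = 0 := by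
  have := hf.sum_X_mul_pderiv
  simp only [h, mul_zero, Finset.sum_const_zero] at this
  have h2 := this.symm
  rw [nsmul_eq_mul, mul_eq_zero] at h2
  rcases h2 with h2 | h2
  · exact absurd h2 (by exact_mod_cast hd)
  · exact h2

lemma degree_one_exists {γ : Fin r →₀ ℕ} (h : γ.degree = 1) :
    ∃ i, γ = Finsupp.single i 1 := by
  classical
  have h0 : γ ≠ 0 := by
    rintro rfl
    simp at h
  obtain ⟨i, hi⟩ := Finsupp.ne_iff.mp h0
  refine ⟨i, ?_⟩
  have hle : Finsupp.single i 1 ≤ γ := by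
    rw [Finsupp.single_le_iff]
    exact Nat.one_le_iff_ne_zero.mpr hi
  have h2 : (γ - Finsupp.single i 1) + Finsupp.single i 1 = γ := tsub_add_cancel_of_le hle
  have h3 := congrArg Finsupp.degree h2
  rw [map_add, Finsupp.degree_single, h] at h3
  have h4 : (γ - Finsupp.single i 1).degree = 0 := by omega
  rw [Finsupp.degree_eq_zero_iff] at h4
  rw [← h2, h4, zero_add]

end Basics

section Hess

variable {K : Type*} {r : ℕ}

/-- Hessian matrix. -/
noncomputable def Hs [CommRing K] (f : MvPolynomial (Fin r) K) :
    Matrix (Fin r) (Fin r) (MvPolynomial (Fin r) K) :=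
  Matrix.of fun i j => pderiv i (pderiv j f)

/-- `A ∈ M_f`, in Hessian form. -/
def IsM [CommRing K] (f : MvPolynomial (Fin r) K) (A : Matrix (Fin r) (Fin r) K) : Prop :=
  A.map (C : K →+* MvPolynomial (Fin r) K) * Hs f =
    Hs f * (A.map (C : K →+* MvPolynomial (Fin r) K)).transpose

/-- `(A∂)_i f`. -/
noncomputable def dA [CommRing K] (A : Matrix (Fin r) (Fin r) K) (f : MvPolynomial (Fin r) K)
    (i : Fin r) : MvPolynomial (Fin r) K := ∑ k, C (A i k) * pderiv k f

lemma isM_iff [CommRing K] (f : MvPolynomial (Fin r) K) (A : Matrix (Fin r) (Fin r) K) :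
    IsM f A ↔ ∀ i j, pderiv j (dA A f i) = pderiv i (dA A f j) := by
  unfold IsM
  rw [← Matrix.ext_iff]
  refine forall_congr' fun i => forall_congr' fun j => ?_
  have h1 : (A.map (C : K →+* MvPolynomial (Fin r) K) * Hs f) i j = pderiv j (dA A f i) := by
    simp only [Matrix.mul_apply, Matrix.map_apply, Hs, Matrix.of_apply, dA, map_sum, pderiv_C_mul]
    exact Finset.sum_congr rfl fun k _ => by rw [pderiv_comm']
  have h2 : (Hs f * (A.map (C : K →+* MvPolynomial (Fin r) K)).transpose) i j
      = pderiv i (dA A f j) := by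
    simp only [Matrix.mul_apply, Matrix.map_apply, Matrix.transpose_apply, Hs, Matrix.of_apply, dA,
      map_sum, pderiv_C_mul]
    exact Finset.sum_congr rfl fun k _ => by rw [mul_comm]
  rw [h1, h2]

lemma dA_mul [CommRing K] (A B : Matrix (Fin r) (Fin r) K) (f : MvPolynomial (Fin r) K)
    (i : Fin r) : dA (A * B) f i = ∑ k, C (A i k) * dA B f k := by
  simp only [dA, Matrix.mul_apply, map_sum, Finset.sum_mul, Finset.mul_sum, map_mul]
  rw [Finset.sum_comm]
  simp only [mul_assoc]

lemma dA_sub [CommRing K] (A B : Matrix (Fin r) (Fin r) K) (f : MvPolynomial (Fin r) K)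
    (i : Fin r) : dA (A - B) f i = dA A f i - dA B f i := by
  simp only [dA, Matrix.sub_apply, map_sub, sub_mul, Finset.sum_sub_distrib]

lemma dA_sub_right [CommRing K] (A : Matrix (Fin r) (Fin r) K) (f g : MvPolynomial (Fin r) K)
    (i : Fin r) : dA A (f - g) i = dA A f i - dA A g i := by
  simp only [dA, map_sub, mul_sub, Finset.sum_sub_distrib]

lemma dA_smul_one [CommRing K] (c : K) (f : MvPolynomial (Fin r) K)
    (i : Fin r) : dA (c • (1 : Matrix (Fin r) (Fin r) K)) f i = C c * pderiv i f := by
  simp only [dA, Matrix.smul_apply, Matrix.one_apply, smul_eq_mul]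
  rw [Finset.sum_eq_single i]
  · simp
  · intro b _ hb
    simp [hb.symm]
  · simp

lemma isM_sub [CommRing K] {f : MvPolynomial (Fin r) K} {A B : Matrix (Fin r) (Fin r) K}
    (hA : IsM f A) (hB : IsM f B) : IsM f (A - B) := by
  rw [isM_iff] at *
  intro i j
  simp only [dA_sub, map_sub, hA i j, hB i j]

lemma isM_smul_one [CommRing K] (f : MvPolynomial (Fin r) K) (c : K) :
    IsM f (c • (1 : Matrix (Fin r) (Fin r) K)) := by
  rw [isM_iff]
  intro i j
  simp only [dA_smul_one, pderiv_C_mul]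
  rw [pderiv_comm']

lemma isM_mul [CommRing K] {f : MvPolynomial (Fin r) K} {A B : Matrix (Fin r) (Fin r) K}
    (hA : IsM f A) (hB : IsM f B) (hc : A * B = B * A) : IsM f (A * B) := by
  unfold IsM at *
  rw [Matrix.map_mul, Matrix.mul_assoc, hB, ← Matrix.mul_assoc, hA, Matrix.mul_assoc,
    ← Matrix.transpose_mul, ← Matrix.map_mul, ← Matrix.map_mul, hc]

lemma isM_add [CommRing K] {f : MvPolynomial (Fin r) K} {A B : Matrix (Fin r) (Fin r) K}
    (hA : IsM f A) (hB : IsM f B) : IsM f (A + B) := by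
  have h0 := isM_sub hA (isM_sub (isM_smul_one f 0) hB)
  simpa using h0

lemma isM_aeval [CommRing K] {f : MvPolynomial (Fin r) K} {A : Matrix (Fin r) (Fin r) K}
    (hA : IsM f A) (p : Polynomial K) : IsM f (Polynomial.aeval A p) := by
  induction p using Polynomial.induction_on with
  | C a =>
    rw [Polynomial.aeval_C, Algebra.algebraMap_eq_smul_one]
    exact isM_smul_one f a
  | add p q hp hq => rw [map_add]; exact isM_add hp hq
  | monomial n a h =>
    rw [pow_succ, ← mul_assoc, map_mul, Polynomial.aeval_X]
    apply isM_mul h hA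
    have := congrArg (Polynomial.aeval A)
      (mul_comm (Polynomial.C a * Polynomial.X ^ n) Polynomial.X)
    simpa only [map_mul, Polynomial.aeval_X] using this

lemma dA_isHomogeneous [CommRing K] (A : Matrix (Fin r) (Fin r) K) {f : MvPolynomial (Fin r) K}
    {d : ℕ} (hf : f.IsHomogeneous d) (i : Fin r) : (dA A f i).IsHomogeneous (d - 1) := by
  apply IsHomogeneous.sum
  intro k _
  simpa using (isHomogeneous_C (Fin r) (A i k)).mul (hf.pderiv (i := k))

lemma poincare [Field K] [CharZero K] {f : MvPolynomial (Fin r) K} {d : ℕ} (hd : 1 ≤ d)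
    (hf : f.IsHomogeneous d) {A : Matrix (Fin r) (Fin r) K} (hA : IsM f A) :
    ∃ g : MvPolynomial (Fin r) K, g.IsHomogeneous d ∧ ∀ i, pderiv i g = dA A f i := by
  have hd0 : (d : K) ≠ 0 := by
    rw [Nat.cast_ne_zero]; omega
  refine ⟨C (d : K)⁻¹ * ∑ j, X j * dA A f j, ?_, ?_⟩
  · have : (∑ j, X j * dA A f j).IsHomogeneous d := by
      apply IsHomogeneous.sum
      intro j _
      have := (isHomogeneous_X K j).mul (dA_isHomogeneous A hf j)
      rwa [show 1 + (d - 1) = d by omega] at this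
    simpa using (isHomogeneous_C (Fin r) (d : K)⁻¹).mul this
  · intro i
    rw [isM_iff] at hA
    have h1 : pderiv i (∑ j, X j * dA A f j) = dA A f i + (d - 1 : ℕ) • dA A f i := by
      rw [← (dA_isHomogeneous A hf i).sum_X_mul_pderiv, map_sum]
      simp only [pderiv_mul, Finset.sum_add_distrib]
      congr 1
      · rw [Finset.sum_eq_single i]
        · simp
        · intro b _ hb
          rw [pderiv_X_of_ne hb, zero_mul]
        · simp
      · exact Finset.sum_congr rfl fun j _ => by rw [hA i j]
    rw [pderiv_C_mul, h1]
    have h2 : dA A f i + (d - 1 : ℕ) • dA A f i = C (d : K) * dA A f i := by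
      obtain ⟨e, rfl⟩ : ∃ e, d = e + 1 := ⟨d - 1, by omega⟩
      simp
      ring
    rw [h2, ← mul_assoc, ← C_mul, inv_mul_cancel₀ hd0, C_1, one_mul]

lemma eq_zero_of_dA [Field K] {f : MvPolynomial (Fin r) K}
    (hann : ∀ D : MvPolynomial (Fin r) K, D.IsHomogeneous 1 → contract D f = 0 → D = 0)
    {A : Matrix (Fin r) (Fin r) K} (h : ∀ i, dA A f i = 0) : A = 0 := by
  classical
  ext i j
  let D : MvPolynomial (Fin r) K := ∑ k, C (A i k) * X k
  have hD : D = 0 := by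
    apply hann
    · apply IsHomogeneous.sum
      intro k _
      simpa using (isHomogeneous_C (Fin r) (A i k)).mul (isHomogeneous_X K k)
    · have : contract D f = dA A f i := by
        change contractL f (∑ k, C (A i k) * X k) = _
        rw [map_sum, dA]
        refine Finset.sum_congr rfl fun k _ => ?_
        change contract _ _ = _
        rw [mul_comm, contract_X_mul, contract_C, Derivation.map_smul, smul_eq_C_mul]
      rw [this, h i]
  have h2 := congrArg (coeff (Finsupp.single j 1)) hD
  simp only [D, coeff_sum, coeff_C_mul, coeff_X, coeff_zero] at h2
  simpa [Finsupp.single_left_inj] using h2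

/-- criterion for a length two regular splitting -/
lemma regSplit_of [Field K] [CharZero K] {d : ℕ} (hd : 1 ≤ d) {g h : MvPolynomial (Fin r) K}
    (hg : g.IsHomogeneous d) (hh : h.IsHomogeneous d) (hg0 : g ≠ 0) (hh0 : h ≠ 0)
    (E : Matrix (Fin r) (Fin r) K) (hEg : ∀ i, dA E g i = pderiv i g)
    (hEh : ∀ i, dA E h i = 0) :
    ∃ G : Set (MvPolynomial (Fin r) K), IsRegSplit d (g + h) G ∧ 2 ≤ G.ncard := by
  classical
  have hne : g ≠ h := by
    rintro rfl
    apply hg0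
    apply eq_zero_of_pderiv (by omega) hg
    intro i
    rw [← hEg, hEh]
  have hdis : Disjoint (partials (d - 1) g) (partials (d - 1) h) := by
    rw [Submodule.disjoint_def]
    intro p hp1 hp2
    have k1 : ∀ i, coeff (Finsupp.single i 1) p
        = ∑ k, E i k * coeff (Finsupp.single k 1) p := by
      intro i
      clear hp2
      induction hp1 using Submodule.span_induction with
      | mem x hx =>
        obtain ⟨D, hD, rfl⟩ := hx
        simp only [coeff_single_contract]
        rw [← hEg, dA, pr_comm, ← prL_apply, map_sum]
        refine Finset.sum_congr rfl fun k _ => ?_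
        rw [← smul_eq_C_mul, map_smul, prL_apply, pr_comm, smul_eq_mul]
      | zero => simp
      | add x y _ _ hx hy => simp only [coeff_add, hx, hy, mul_add, Finset.sum_add_distrib]
      | smul c x _ hx =>
        simp only [coeff_smul, smul_eq_mul]
        rw [hx, Finset.mul_sum]
        exact Finset.sum_congr rfl fun k _ => by ring
    have k2 : ∀ i, ∑ k, E i k * coeff (Finsupp.single k 1) p = 0 := by
      intro i
      clear k1 hp1
      induction hp2 using Submodule.span_induction with
      | mem x hx =>
        obtain ⟨D, hD, rfl⟩ := hx
        simp only [coeff_single_contract]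
        have h1 : pr D (dA E h i) = 0 := by rw [hEh, pr_comm, ← prL_apply, map_zero]
        rw [← h1, dA, pr_comm, ← prL_apply, map_sum]
        refine Finset.sum_congr rfl fun k _ => ?_
        rw [← smul_eq_C_mul, map_smul, prL_apply, pr_comm, smul_eq_mul]
      | zero => simp
      | add x y _ _ hx hy =>
        simp only [coeff_add, mul_add, Finset.sum_add_distrib, hx, hy, add_zero]
      | smul c x _ hx =>
        simp only [coeff_smul, smul_eq_mul]
        rw [← mul_zero c, ← hx, Finset.mul_sum]
        exact Finset.sum_congr rfl fun k _ => by ring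
    have k3 : p.IsHomogeneous 1 := by
      rw [← mem_homogeneousSubmodule]
      refine (Submodule.span_le.mpr ?_) hp1
      rintro x ⟨D, hD, rfl⟩
      rw [SetLike.mem_coe, mem_homogeneousSubmodule]
      apply contract_isHomogeneous hD
      rwa [Nat.sub_add_cancel hd]
    ext γ
    by_cases hγ : γ.degree = 1
    · obtain ⟨i, rfl⟩ := degree_one_exists hγ
      rw [k1, k2, coeff_zero]
    · rw [k3.coeff_eq_zero hγ, coeff_zero]
  refine ⟨{g, h}, ⟨by simp, by simp, ?_, ?_, ?_⟩, ?_⟩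
  · rintro x (rfl | rfl)
    · exact ⟨hg0, hg⟩
    · exact ⟨hh0, hh⟩
  · exact finsum_mem_pair hne
  · rintro x (rfl | rfl)
    · have : ({x, h} : Set (MvPolynomial (Fin r) K)) \ {x} = {h} := by
        ext y; simp; rintro rfl; exact hne.symm
      rw [this]; simpa using hdis
    · have : ({g, x} : Set (MvPolynomial (Fin r) K)) \ {x} = {g} := by
        ext y; simp; constructor
        · tauto
        · rintro rfl; exact ⟨Or.inl rfl, hne⟩
      rw [this]; simpa using hdis.symm
  · rw [Set.ncard_pair hne]

lemma linform_expand [CommRing K] {p : MvPolynomial (Fin r) K} (hp : p.IsHomogeneous 1) :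
    p = ∑ k, coeff (Finsupp.single k 1) p • X k := by
  classical
  ext γ
  by_cases hγ : γ.degree = 1
  · obtain ⟨i, rfl⟩ := degree_one_exists hγ
    simp [coeff_sum, coeff_X, Finsupp.single_left_inj]
  · rw [hp.coeff_eq_zero hγ, IsHomogeneous.coeff_eq_zero (n := 1) _ hγ]
    apply IsHomogeneous.sum
    intro k _
    rw [smul_eq_C_mul]
    simpa using (isHomogeneous_C (Fin r) _).mul (isHomogeneous_X K k)

/-- a regular splitting gives a nonscalar element of `M_f`. -/
lemma exists_isM_of_split [Field K] [CharZero K] {d : ℕ} (hd : 1 ≤ d)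
    {f : MvPolynomial (Fin r) K} {G : Set (MvPolynomial (Fin r) K)} (hG : IsRegSplit d f G)
    (hc : 2 ≤ G.ncard) : ∃ A : Matrix (Fin r) (Fin r) K, IsM f A ∧ ∀ c : K, A ≠ c • 1 := by
  classical
  obtain ⟨hfin, -, hmem, hsum, hdis⟩ := hG
  obtain ⟨g, hg, g', hg', hne⟩ : ∃ g ∈ G, ∃ g' ∈ G, g ≠ g' := by
    have := (Set.one_lt_ncard (hs := hfin)).mp (by omega : 1 < G.ncard)
    exact this
  have hdisg := hdis g hg
  obtain ⟨U, hU1, hU2⟩ := hdisg.exists_isCompl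
  have hPhom : ∀ h ∈ G, ∀ D : MvPolynomial (Fin r) K, D.IsHomogeneous (d - 1) →
      (contract D h).IsHomogeneous 1 := by
    intro h hh D hD
    apply contract_isHomogeneous hD
    rw [Nat.sub_add_cancel hd]
    exact (hmem h hh).2
  let π : MvPolynomial (Fin r) K →ₗ[K] MvPolynomial (Fin r) K := Submodule.projection _ _ hU2
  let A : Matrix (Fin r) (Fin r) K :=
    Matrix.of fun i j => coeff (Finsupp.single i 1) (π (X j))
  have key : ∀ h ∈ G, ∀ D : MvPolynomial (Fin r) K, D.IsHomogeneous (d - 1) → ∀ i,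
      pr D (dA A h i) = coeff (Finsupp.single i 1) (π (contract D h)) := by
    intro h hh D hD i
    have e1 : pr D (dA A h i) = ∑ k, A i k * pr D (pderiv k h) := by
      rw [dA, pr_comm, ← prL_apply, map_sum]
      refine Finset.sum_congr rfl fun k _ => ?_
      rw [← smul_eq_C_mul, map_smul, prL_apply, pr_comm, smul_eq_mul]
    rw [e1]
    conv_rhs => rw [linform_expand (hPhom h hh D hD), map_sum, coeff_sum]
    refine Finset.sum_congr rfl fun k _ => ?_
    rw [map_smul, coeff_smul, coeff_single_contract, smul_eq_mul, mul_comm]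
    rfl
  have hAg : ∀ i, dA A g i = pderiv i g := by
    intro i
    rw [← sub_eq_zero]
    apply eq_zero_of_pr (e := d - 1)
    · exact (dA_isHomogeneous A (hmem g hg).2 i).sub (hmem g hg).2.pderiv
    · intro D hD
      rw [pr_comm, ← prL_apply, map_sub, prL_apply, prL_apply, pr_comm, pr_comm _ D,
        key g hg D hD i, ← coeff_single_contract]
      have : π (contract D g) = contract D g := by
        apply Submodule.projection_apply_of_mem_left
        exact hU1 (Submodule.subset_span ⟨D, hD, rfl⟩)
      rw [this, sub_self]
  have hAh : ∀ h ∈ G, h ≠ g → ∀ i, dA A h i = 0 := by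
    intro h hh hhg i
    apply eq_zero_of_pr (e := d - 1)
    · exact (dA_isHomogeneous A (hmem h hh).2 i)
    · intro D hD
      rw [key h hh D hD i]
      have : π (contract D h) = 0 := by
        apply (Submodule.projection_apply_eq_zero_iff hU2).mpr
        refine (le_iSup₂_of_le (f := fun h (_ : h ∈ G \ {g}) => partials (d - 1) h) h ⟨hh, hhg⟩ le_rfl) ?_
        exact (Submodule.subset_span ⟨D, hD, rfl⟩)
      rw [this, coeff_zero]
  have hAf : ∀ i, dA A f i = pderiv i g := by
    intro i
    let φ : MvPolynomial (Fin r) K →+ MvPolynomial (Fin r) K :=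
      { toFun := fun p => dA A p i
        map_zero' := by simp [dA]
        map_add' := fun p q => by simp [dA, mul_add, Finset.sum_add_distrib] }
    change φ f = _
    rw [← hsum, finsum_mem_eq_finite_toFinset_sum _ hfin, map_sum,
      Finset.sum_eq_single g]
    · exact hAg i
    · intro b hb hbg
      exact hAh b (hfin.mem_toFinset.mp hb) hbg i
    · intro h
      exact absurd (hfin.mem_toFinset.mpr hg) h
  refine ⟨A, ?_, ?_⟩
  · rw [isM_iff]
    intro i j
    rw [hAf, hAf, pderiv_comm']
  · intro c hc
    have h1 : c = 0 := by
      by_contra hc0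
      apply (hmem g' hg').1
      apply eq_zero_of_pderiv (by omega) (hmem g' hg').2
      intro i
      have := hAh g' hg' hne.symm i
      rw [hc, dA_smul_one, mul_eq_zero, C_eq_zero] at this
      exact this.resolve_left hc0
    apply (hmem g hg).1
    apply eq_zero_of_pderiv (by omega) (hmem g hg).2
    intro i
    rw [← hAg i, hc, dA_smul_one, h1, C_0, zero_mul]

end Hess

section Generators

variable {K : Type*} {r : ℕ}

/-- A nonscalar element of `M_f` gives a generator of degree `d`. -/
lemma generator_of_isM [Field K] [CharZero K] {d : ℕ} (hd : 1 ≤ d)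
    (f : MvPolynomial (Fin r) K) (hf : f.IsHomogeneous d)
    (hann : ∀ D : MvPolynomial (Fin r) K, D.IsHomogeneous 1 → contract D f = 0 → D = 0)
    {A : Matrix (Fin r) (Fin r) K} (hA : IsM f A) (hns : ∀ c : K, A ≠ c • 1) :
    ∃ D : MvPolynomial (Fin r) K, D.IsHomogeneous d ∧ contract D f = 0 ∧
      D ∉ Submodule.span K {p : MvPolynomial (Fin r) K |
        ∃ i, ∃ E : MvPolynomial (Fin r) K,
          E.IsHomogeneous (d - 1) ∧ contract E f = 0 ∧ p = X i * E} := by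
  obtain ⟨g, hg, hgA⟩ := poincare hd hf hA
  have hgf : g ∉ Submodule.span K {f} := by
    intro h
    obtain ⟨c, hc⟩ := Submodule.mem_span_singleton.mp h
    apply hns c
    rw [← sub_eq_zero]
    apply eq_zero_of_dA hann
    intro i
    rw [dA_sub, dA_smul_one, ← hgA, ← hc, Derivation.map_smul, smul_eq_C_mul, sub_self]
  obtain ⟨D, hD, hD1, hD2⟩ := exists_pr_separating hg (Submodule.span K {f}) (by
    intro w hw
    obtain ⟨c, rfl⟩ := Submodule.mem_span_singleton.mp hw
    rw [smul_eq_C_mul]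
    simpa using (isHomogeneous_C (Fin r) c).mul hf) hgf
  refine ⟨D, hD, ?_, ?_⟩
  · rw [contract_eq_zero_iff hD hf, pr_comm]
    exact hD1 f (Submodule.mem_span_singleton_self f)
  · intro h
    apply hD2
    rw [pr_comm, ← prL_apply]
    have : Submodule.span K {p : MvPolynomial (Fin r) K |
        ∃ i, ∃ E : MvPolynomial (Fin r) K,
          E.IsHomogeneous (d - 1) ∧ contract E f = 0 ∧ p = X i * E} ≤ LinearMap.ker (prL g) := by
      rw [Submodule.span_le]
      rintro p ⟨i, E, hE, hEf, rfl⟩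
      rw [SetLike.mem_coe, LinearMap.mem_ker, prL_apply, pr_X_mul, hgA, dA, pr_comm,
        ← prL_apply, map_sum]
      apply Finset.sum_eq_zero
      intro k _
      rw [← smul_eq_C_mul, map_smul, prL_apply, pr_comm, pr, contract_pderiv, hEf]
      simp
    exact this h

lemma isM_of_generator [Field K] [CharZero K] {d : ℕ} (hd : 1 ≤ d)
    (f : MvPolynomial (Fin r) K) (hf : f.IsHomogeneous d)
    {D : MvPolynomial (Fin r) K} (hD : D.IsHomogeneous d) (hDf : contract D f = 0)
    (hDS : D ∉ Submodule.span K {p : MvPolynomial (Fin r) K |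
        ∃ i, ∃ E : MvPolynomial (Fin r) K,
          E.IsHomogeneous (d - 1) ∧ contract E f = 0 ∧ p = X i * E}) :
    ∃ A : Matrix (Fin r) (Fin r) K, IsM f A ∧ ∀ c : K, A ≠ c • 1 := by
  obtain ⟨g, hg, hg1, hg2⟩ := exists_pr_separating hD _ (by
    intro w hw
    rw [← mem_homogeneousSubmodule]
    refine (Submodule.span_le.mpr ?_) hw
    rintro x ⟨i, E, hE, -, rfl⟩
    rw [SetLike.mem_coe, mem_homogeneousSubmodule]
    have := (isHomogeneous_X K i).mul hE
    rwa [show 1 + (d - 1) = d by omega] at this) hDS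
  have hmem : ∀ i, pderiv i g ∈ Submodule.span K (Set.range fun k => pderiv k f) := by
    intro i
    by_contra hni
    obtain ⟨E, hE, hE1, hE2⟩ := exists_pr_separating (hg.pderiv (i := i)) _ (by
      intro w hw
      rw [← mem_homogeneousSubmodule]
      refine (Submodule.span_le.mpr ?_) hw
      rintro x ⟨k, rfl⟩
      rw [SetLike.mem_coe, mem_homogeneousSubmodule]
      exact hf.pderiv) hni
    apply hE2
    rw [pr_comm, ← pr_X_mul]
    apply hg1
    apply Submodule.subset_span
    refine ⟨i, E, hE, ?_, rfl⟩
    have h1 : (contract E f).IsHomogeneous 1 := by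
      apply contract_isHomogeneous hE
      rwa [Nat.sub_add_cancel hd]
    rw [linform_expand h1]
    apply Finset.sum_eq_zero
    intro k _
    rw [coeff_single_contract, pr_comm, hE1 _ (Submodule.subset_span ⟨k, rfl⟩), zero_smul]
  have hc : ∀ i, ∃ c : Fin r → K, ∑ k, c k • pderiv k f = pderiv i g := fun i =>
    (Submodule.mem_span_range_iff_exists_fun K).mp (hmem i)
  choose a ha using hc
  have hA : ∀ i, dA (Matrix.of a) f i = pderiv i g := by
    intro i
    rw [← ha i, dA]
    simp only [smul_eq_C_mul, Matrix.of_apply]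
  refine ⟨Matrix.of a, ?_, ?_⟩
  · rw [isM_iff]
    intro i j
    rw [hA, hA, pderiv_comm']
  · intro c hc
    apply hg2
    have h2 : g - c • f = 0 := by
      apply eq_zero_of_pderiv (d := d) (by omega)
      · apply hg.sub
        rw [smul_eq_C_mul]
        simpa using (isHomogeneous_C (Fin r) c).mul hf
      · intro i
        rw [map_sub, ← hA, hc, dA_smul_one, Derivation.map_smul, smul_eq_C_mul, sub_self]
    rw [sub_eq_zero.mp h2, pr, contract_smul_right, hDf]
    simp

/-- dichotomy -/
lemma dichotomy [Field K] [IsAlgClosed K] (A : Matrix (Fin r) (Fin r) K)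
    (hns : ∀ c : K, A ≠ c • 1) :
    (∃ p : Polynomial K, Polynomial.aeval A p * Polynomial.aeval A p = Polynomial.aeval A p ∧
      Polynomial.aeval A p ≠ 0 ∧ Polynomial.aeval A p ≠ 1) ∨
    (∃ p : Polynomial K, Polynomial.aeval A p * Polynomial.aeval A p = 0 ∧
      Polynomial.aeval A p ≠ 0) := by
  classical
  have hint : IsIntegral K A := Matrix.isIntegral A
  have hnt : Nontrivial (Matrix (Fin r) (Fin r) K) := by
    refine ⟨A, 0, ?_⟩
    simpa using hns 0
  have hdeg : (minpoly K A).degree ≠ 0 := (minpoly.degree_pos hint).ne'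
  obtain ⟨l, hl⟩ := IsAlgClosed.exists_root (minpoly K A) hdeg
  have hm0 : minpoly K A ≠ 0 := minpoly.ne_zero hint
  obtain ⟨q, hq, hql⟩ := Polynomial.exists_eq_pow_rootMultiplicity_mul_and_not_dvd
    (minpoly K A) hm0 l
  set k := (minpoly K A).rootMultiplicity l with hk
  have hk0 : 0 < k := (Polynomial.rootMultiplicity_pos hm0).mpr hl
  set L : Polynomial K := Polynomial.X - Polynomial.C l with hL
  have hcop : IsCoprime (L ^ k) q := by
    apply IsCoprime.pow_left
    exact ((Polynomial.irreducible_X_sub_C l).coprime_iff_not_dvd).mpr hql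
  obtain ⟨a, b, hab⟩ := hcop
  have haev : Polynomial.aeval A (minpoly K A) = 0 := minpoly.aeval K A
  by_cases hqu : IsUnit q
  · right
    have hLk : Polynomial.aeval A L ^ k = 0 := by
      obtain ⟨u, rfl⟩ := hqu
      have : L ^ k = minpoly K A * (↑u⁻¹ : Polynomial K) := by
        rw [hq, mul_assoc, Units.mul_inv, mul_one]
      rw [← map_pow, this, map_mul, haev, zero_mul]
    have hL0 : Polynomial.aeval A L ≠ 0 := by
      intro h
      apply hns l
      rw [hL, map_sub, Polynomial.aeval_X, Polynomial.aeval_C, sub_eq_zero] at h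
      rw [h, Algebra.algebraMap_eq_smul_one]
    have hex : ∃ n, Polynomial.aeval A L ^ n = 0 := ⟨k, hLk⟩
    have hn := Nat.find_spec hex
    have hmin := fun m => Nat.find_min hex (m := m)
    set n := Nat.find hex
    have hn2 : 2 ≤ n := by
      by_contra h
      have : n = 0 ∨ n = 1 := by omega
      rcases this with h | h
      · rw [h, pow_zero] at hn
        exact one_ne_zero hn
      · rw [h, pow_one] at hn
        exact hL0 hn
    refine ⟨L ^ (n - 1), ?_, ?_⟩
    · rw [map_pow, ← pow_add, show n - 1 + (n - 1) = n + (n - 2) by omega, pow_add, hn, zero_mul]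
    · rw [map_pow]
      exact hmin (n - 1) (by omega)
  · left
    have hsum : Polynomial.aeval A (a * L ^ k) + Polynomial.aeval A (b * q) = 1 := by
      rw [← map_add, hab, map_one]
    have hprod : Polynomial.aeval A (a * L ^ k) * Polynomial.aeval A (b * q) = 0 := by
      rw [← map_mul, show a * L ^ k * (b * q) = a * b * (L ^ k * q) by ring, ← hq, map_mul, haev,
        mul_zero]
    refine ⟨a * L ^ k, ?_, ?_, ?_⟩
    · have h1 := congrArg (fun z => Polynomial.aeval A (a * L ^ k) * z) hsum
      simpa only [mul_add, hprod, add_zero, mul_one] using h1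
    · intro h
      apply hqu
      apply isUnit_of_dvd_one
      rw [← hab]
      apply dvd_add _ (dvd_mul_left _ _)
      refine dvd_trans ?_ (minpoly.dvd K A h)
      exact ⟨L ^ k, by rw [mul_comm]; exact hq⟩
    · intro h
      rw [h, add_eq_left] at hsum
      have h1 : IsUnit (L ^ k) := by
        apply isUnit_of_dvd_one
        rw [← hab]
        apply dvd_add (dvd_mul_left _ _)
        refine dvd_trans ?_ (minpoly.dvd K A hsum)
        exact ⟨q, hq⟩
      rw [isUnit_pow_iff hk0.ne'] at h1
      exact Polynomial.not_isUnit_X_sub_C l h1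

/-- generalized inverse -/
lemma exists_ginv [Field K] (N : Matrix (Fin r) (Fin r) K) :
    ∃ S : Matrix (Fin r) (Fin r) K, N * S * N = N := by
  classical
  let φ := Matrix.toLin' N
  obtain ⟨s, hs⟩ := φ.rangeRestrict.exists_rightInverse_of_surjective φ.range_rangeRestrict
  obtain ⟨σ, hσ⟩ := LinearMap.exists_extend s
  refine ⟨LinearMap.toMatrix' σ, ?_⟩
  apply Matrix.toLin'.injective
  rw [Matrix.toLin'_mul, Matrix.toLin'_mul, Matrix.toLin'_toMatrix']
  apply LinearMap.ext
  intro y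
  have h1 : σ (φ y) = s (φ.rangeRestrict y) := by
    rw [← hσ]
    rfl
  have h2 := congrArg Subtype.val (LinearMap.congr_fun hs (φ.rangeRestrict y))
  change φ (σ (φ y)) = φ y
  rw [h1]
  exact h2

end Generators

section Special

variable {r : ℕ}

lemma dA_map {R S : Type*} [CommRing R] [CommRing S] (φ : R →+* S)
    (A : Matrix (Fin r) (Fin r) R) (f : MvPolynomial (Fin r) R) (i : Fin r) :
    dA (A.map φ) (map φ f) i = map φ (dA A f i) := by
  simp [dA, pderiv_map]

lemma isM_map {R S : Type*} [CommRing R] [CommRing S] (φ : R →+* S)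
    {A : Matrix (Fin r) (Fin r) R} {f : MvPolynomial (Fin r) R} (h : IsM f A) :
    IsM (map φ f) (A.map φ) := by
  rw [isM_iff] at *
  intro i j
  rw [dA_map, dA_map, pderiv_map, pderiv_map, h i j]

lemma isM_of_map {R S : Type*} [CommRing R] [CommRing S] (φ : R →+* S)
    (hφ : Function.Injective φ)
    {A : Matrix (Fin r) (Fin r) R} {f : MvPolynomial (Fin r) R}
    (h : IsM (map φ f) (A.map φ)) : IsM f A := by
  rw [isM_iff] at *
  intro i j
  have := h i j
  rw [dA_map, dA_map, pderiv_map, pderiv_map] at this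
  exact map_injective φ hφ this

lemma dA_smul {R : Type*} [CommRing R] (c : R) (A : Matrix (Fin r) (Fin r) R)
    (f : MvPolynomial (Fin r) R) (i : Fin r) : dA (c • A) f i = C c * dA A f i := by
  simp [dA, Finset.mul_sum, mul_assoc]

lemma isM_smul {R : Type*} [CommRing R] (c : R) {A : Matrix (Fin r) (Fin r) R}
    {f : MvPolynomial (Fin r) R} (h : IsM f A) : IsM f (c • A) := by
  rw [isM_iff] at *
  intro i j
  rw [dA_smul, dA_smul, pderiv_C_mul, pderiv_C_mul, h i j]

lemma isM_of_smul {R : Type*} [CommRing R] [IsDomain R] {c : R} (hc : c ≠ 0)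
    {A : Matrix (Fin r) (Fin r) R}
    {f : MvPolynomial (Fin r) R} (h : IsM f (c • A)) : IsM f A := by
  rw [isM_iff] at *
  intro i j
  have := h i j
  rw [dA_smul, dA_smul, pderiv_C_mul, pderiv_C_mul] at this
  exact mul_left_cancel₀ (by simpa using hc) this

lemma specialize_isM {K : Type*} [Field K] [CharZero K] {n : ℕ}
    (ft : MvPolynomial (Fin r) (MvPolynomial (Fin n) K))
    {A : Matrix (Fin r) (Fin r) (FractionRing (MvPolynomial (Fin n) K))}
    (hA : IsM (MvPolynomial.map (algebraMap (MvPolynomial (Fin n) K)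
            (FractionRing (MvPolynomial (Fin n) K))) ft) A)
    (hns : ∀ c : FractionRing (MvPolynomial (Fin n) K), A ≠ c • 1) :
    ∃ A0 : Matrix (Fin r) (Fin r) K,
      IsM (MvPolynomial.map (MvPolynomial.eval (0 : Fin n → K)) ft) A0 ∧
      ∀ c : K, A0 ≠ c • 1 := by
  classical
  have hr : Nonempty (Fin r) := by
    by_contra h
    rw [not_nonempty_iff] at h
    exact hns 0 (Subsingleton.elim _ _)
  obtain ⟨i0⟩ := hr
  let A1 := A - A i0 i0 • 1
  have hA1 : IsM _ A1 := isM_sub hA (isM_smul_one _ (A i0 i0))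
  have hA10 : A1 ≠ 0 := fun h => hns (A i0 i0) (sub_eq_zero.mp h)
  have hA1i : A1 i0 i0 = 0 := by simp [A1]
  obtain ⟨b, hb⟩ := IsLocalization.exist_integer_multiples_of_finite
    (nonZeroDivisors (MvPolynomial (Fin n) K)) (fun x : Fin r × Fin r => A1 x.1 x.2)
  choose B0 hB0 using hb
  let ι := algebraMap (MvPolynomial (Fin n) K) (FractionRing (MvPolynomial (Fin n) K))
  have hι : Function.Injective ι := IsFractionRing.injective _ _
  let B : Matrix (Fin r) (Fin r) (MvPolynomial (Fin n) K) := Matrix.of fun i j => B0 (i, j)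
  have hBe : ∀ i j, ι (B i j) = ι b * A1 i j := by
    intro i j
    have := hB0 (i, j)
    rw [Algebra.smul_def] at this
    exact this
  have hBA : B.map ι = ι b • A1 := by
    ext i j
    rw [Matrix.map_apply, hBe]
    rfl
  have hb0 : ι b ≠ 0 := by
    rw [Ne, map_eq_zero_iff ι hι]
    exact nonZeroDivisors.ne_zero b.2
  have hBM : IsM ft B := by
    apply isM_of_map ι hι
    rw [hBA]
    exact isM_smul _ hA1
  have hBi : B i0 i0 = 0 := by
    apply hι
    rw [hBe, hA1i, mul_zero, map_zero]
  obtain ⟨i, j, hij⟩ : ∃ i j, B i j ≠ 0 := by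
    by_contra! h
    apply hA10
    ext i j
    have := hBe i j
    rw [h, map_zero] at this
    exact (mul_eq_zero.mp this.symm).resolve_left hb0
  obtain ⟨c, hc⟩ : ∃ c : Fin n → K, eval c (B i j) ≠ 0 := by
    by_contra! h
    apply hij
    apply MvPolynomial.funext
    intro x
    rw [h, map_zero]
  let ψ : MvPolynomial (Fin n) K →+* Polynomial K :=
    (aeval (fun l => Polynomial.C (c l) * Polynomial.X) :
      MvPolynomial (Fin n) K →ₐ[K] Polynomial K).toRingHom
  have hψ0 : (Polynomial.evalRingHom 0).comp ψ = eval (0 : Fin n → K) := by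
    apply MvPolynomial.ringHom_ext
    · intro a
      simp [ψ]
    · intro l
      simp [ψ]
  have hψ1 : (Polynomial.evalRingHom 1).comp ψ = eval c := by
    apply MvPolynomial.ringHom_ext
    · intro a
      simp [ψ]
    · intro l
      simp [ψ]
  have hBψ : ψ (B i j) ≠ 0 := by
    intro h
    apply hc
    rw [← hψ1, RingHom.comp_apply, h, map_zero]
  have hex : ∃ k, ∃ i j, (ψ (B i j)).coeff k ≠ 0 := by
    by_contra! h
    apply hBψ
    ext k
    rw [h, Polynomial.coeff_zero]
  obtain ⟨i', j', hk⟩ := Nat.find_spec hex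
  have hmin := fun m => Nat.find_min hex (m := m)
  set k := Nat.find hex
  have hdvd : ∀ i j, Polynomial.X ^ k ∣ ψ (B i j) := by
    intro i j
    rw [Polynomial.X_pow_dvd_iff]
    intro m hm
    by_contra h
    exact hmin m hm ⟨i, j, h⟩
  choose Q hQ using hdvd
  let B3 : Matrix (Fin r) (Fin r) (Polynomial K) := Matrix.of Q
  have hB3 : B.map ψ = (Polynomial.X ^ k : Polynomial K) • B3 := by
    ext1 i j
    rw [Matrix.map_apply, hQ]
    rfl
  have hB3M : IsM (map ψ ft) B3 := by
    apply isM_of_smul (c := (Polynomial.X ^ k : Polynomial K)) (pow_ne_zero _ Polynomial.X_ne_zero)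
    rw [← hB3]
    exact isM_map ψ hBM
  refine ⟨B3.map (Polynomial.evalRingHom 0), ?_, ?_⟩
  · have := isM_map (Polynomial.evalRingHom 0) hB3M
    rwa [map_map, hψ0] at this
  · intro e he
    have h1 : e = 0 := by
      have h2 := congrFun (congrFun he i0) i0
      have h3 : Q i0 i0 = 0 := by
        have := hQ i0 i0
        rw [hBi, map_zero] at this
        exact (mul_eq_zero.mp this.symm).resolve_left (pow_ne_zero _ Polynomial.X_ne_zero)
      simpa [B3, h3] using h2.symm
    have h2 := congrFun (congrFun he i') j'
    apply hk
    rw [hQ, Polynomial.coeff_X_pow_mul', if_pos le_rfl, Nat.sub_self]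
    simpa [B3, h1, Polynomial.coeff_zero_eq_eval_zero] using h2

end Special

section Degenerate

variable {r : ℕ}

/-- matrix action on vectors of polynomials -/
noncomputable def mv {R : Type*} [CommRing R] (A : Matrix (Fin r) (Fin r) R)
    (w : Fin r → MvPolynomial (Fin r) R) (i : Fin r) : MvPolynomial (Fin r) R :=
  ∑ m, C (A i m) * w m

lemma mv_mul {R : Type*} [CommRing R] (A B : Matrix (Fin r) (Fin r) R)
    (w : Fin r → MvPolynomial (Fin r) R) : mv (A * B) w = mv A (mv B w) := by
  ext1 i
  simp only [mv, Matrix.mul_apply, map_sum, Finset.sum_mul, Finset.mul_sum, map_mul]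
  rw [Finset.sum_comm]
  simp only [mul_assoc]

lemma dA_eq_mv {R : Type*} [CommRing R] (A : Matrix (Fin r) (Fin r) R)
    (f : MvPolynomial (Fin r) R) : dA A f = mv A (fun k => pderiv k f) := rfl

lemma mv_zero_right {R : Type*} [CommRing R] (A : Matrix (Fin r) (Fin r) R) :
    mv A (fun _ => 0) = fun _ => 0 := by
  ext1 i
  simp [mv]

lemma mv_zero_left {R : Type*} [CommRing R] (w : Fin r → MvPolynomial (Fin r) R) :
    mv 0 w = fun _ => 0 := by
  ext1 i
  simp [mv]

/-- image of the variable `x_l` under `S`. -/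
noncomputable def yS {R : Type*} [CommRing R] (S : Matrix (Fin r) (Fin r) R) (l : Fin r) :
    MvPolynomial (Fin r) R := ∑ j, C (S j l) * X j

lemma pderiv_yS {R : Type*} [CommRing R] (S : Matrix (Fin r) (Fin r) R) (k l : Fin r) :
    pderiv k (yS S l) = C (S k l) := by
  classical
  simp only [yS, map_sum, pderiv_C_mul]
  rw [Finset.sum_eq_single k]
  · simp
  · intro b _ hb
    rw [pderiv_X_of_ne hb, mul_zero]
  · simp

lemma yS_hom {R : Type*} [CommRing R] (S : Matrix (Fin r) (Fin r) R) (l : Fin r) :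
    (yS S l).IsHomogeneous 1 := by
  apply IsHomogeneous.sum
  intro k _
  simpa using (isHomogeneous_C (Fin r) (S k l)).mul (isHomogeneous_X R k)

/-- The substitution `1 + τ S`. -/
noncomputable def sb {R : Type*} [CommRing R] (τ : R) (S : Matrix (Fin r) (Fin r) R) :
    MvPolynomial (Fin r) R →ₐ[R] MvPolynomial (Fin r) R :=
  aeval (fun l => X l + C τ * yS S l)

/-- The derivation along `S`. -/
noncomputable def dS {R : Type*} [CommRing R] (S : Matrix (Fin r) (Fin r) R)
    (g : MvPolynomial (Fin r) R) : MvPolynomial (Fin r) R := ∑ l, yS S l * pderiv l g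

lemma dS_mul_X {R : Type*} [CommRing R] (S : Matrix (Fin r) (Fin r) R)
    (p : MvPolynomial (Fin r) R) (m : Fin r) : dS S (p * X m) = dS S p * X m + p * yS S m := by
  classical
  simp only [dS, pderiv_mul, mul_add, Finset.sum_add_distrib, Finset.sum_mul]
  congr 1
  · exact Finset.sum_congr rfl fun l _ => by ring
  · rw [Finset.sum_eq_single m]
    · simp [mul_comm]
    · intro b _ hb
      rw [pderiv_X_of_ne hb.symm, mul_zero, mul_zero]
    · simp

lemma taylor {R : Type*} [CommRing R] (τ : R) (S : Matrix (Fin r) (Fin r) R)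
    (g : MvPolynomial (Fin r) R) :
    ∃ q, sb τ S g = g + C τ * dS S g + C τ * (C τ * q) := by
  induction g using MvPolynomial.induction_on with
  | C a => exact ⟨0, by simp [sb, dS]⟩
  | add p q hp hq =>
    obtain ⟨u, hu⟩ := hp
    obtain ⟨v, hv⟩ := hq
    refine ⟨u + v, ?_⟩
    have : dS S (p + q) = dS S p + dS S q := by
      simp [dS, mul_add, Finset.sum_add_distrib]
    rw [map_add, hu, hv, this]
    ring
  | mul_X p m hp =>
    obtain ⟨u, hu⟩ := hp
    refine ⟨u * X m + u * (C τ * yS S m) + dS S p * yS S m, ?_⟩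
    have : sb τ S (X m) = X m + C τ * yS S m := by simp [sb]
    rw [map_mul, hu, this, dS_mul_X]
    ring

lemma pderiv_sb {R : Type*} [CommRing R] (τ : R) (S : Matrix (Fin r) (Fin r) R)
    (g : MvPolynomial (Fin r) R) (k : Fin r) :
    pderiv k (sb τ S g) = mv (1 + τ • S) (fun l => sb τ S (pderiv l g)) k := by
  classical
  induction g using MvPolynomial.induction_on with
  | C a => simp [sb, mv]
  | add p q hp hq => simp only [map_add, hp, hq, mv, mul_add, Finset.sum_add_distrib]
  | mul_X p m hp =>
    have h1 : sb τ S (X m) = X m + C τ * yS S m := by simp [sb]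
    have h2 : pderiv k (sb τ S (X m)) = C ((1 + τ • S) k m) := by
      rw [h1, map_add, pderiv_C_mul, pderiv_yS]
      by_cases h : m = k
      · subst h
        simp
      · rw [pderiv_X_of_ne h, Matrix.add_apply, Matrix.one_apply_ne (Ne.symm h)]
        simp
    rw [map_mul, pderiv_mul, hp, h2]
    simp only [mv, pderiv_mul, map_add, map_mul, mul_add, Finset.sum_add_distrib, Finset.sum_mul]
    congr 1
    · exact Finset.sum_congr rfl fun l _ => by ring
    · rw [Finset.sum_eq_single m]
      · simp [mul_comm]
      · intro b _ hb
        rw [pderiv_X_of_ne hb.symm]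
        simp
      · simp

lemma sb_map {R T : Type*} [CommRing R] [CommRing T] (φ : R →+* T) (τ : R)
    (S : Matrix (Fin r) (Fin r) R) (g : MvPolynomial (Fin r) R) :
    map φ (sb τ S g) = sb (φ τ) (S.map φ) (map φ g) := by
  induction g using MvPolynomial.induction_on with
  | C a => simp [sb]
  | add p q hp hq => simp only [map_add, hp, hq]
  | mul_X p m hp =>
    simp only [map_mul, hp]
    congr 1
    simp [sb, yS]

lemma dS_map {R T : Type*} [CommRing R] [CommRing T] (φ : R →+* T)
    (S : Matrix (Fin r) (Fin r) R) (g : MvPolynomial (Fin r) R) :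
    map φ (dS S g) = dS (S.map φ) (map φ g) := by
  simp [dS, yS, pderiv_map]

lemma dS_hom {R : Type*} [CommRing R] (S : Matrix (Fin r) (Fin r) R)
    {g : MvPolynomial (Fin r) R} {d : ℕ} (hd : 1 ≤ d) (hg : g.IsHomogeneous d) :
    (dS S g).IsHomogeneous d := by
  apply IsHomogeneous.sum
  intro l _
  have := (yS_hom S l).mul (hg.pderiv (i := l))
  rwa [show 1 + (d - 1) = d by omega] at this

lemma sb_hom {R : Type*} [CommRing R] (τ : R) (S : Matrix (Fin r) (Fin r) R)
    {g : MvPolynomial (Fin r) R} {d : ℕ} (hg : g.IsHomogeneous d) :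
    (sb τ S g).IsHomogeneous d := by
  have := hg.aeval (fun l => X l + C τ * yS S l) (n := 1) (by
    intro l
    apply (isHomogeneous_X R l).add
    simpa using (isHomogeneous_C (Fin r) τ).mul (yS_hom S l))
  simpa [sb] using this

lemma C_mul_hom {R : Type*} [CommRing R] (τ : R)
    {g : MvPolynomial (Fin r) R} {d : ℕ} (hg : g.IsHomogeneous d) :
    (C τ * g).IsHomogeneous d := by
  simpa using (isHomogeneous_C (Fin r) τ).mul hg

lemma dA_dS {R : Type*} [CommRing R] {N S : Matrix (Fin r) (Fin r) R}
    {f g : MvPolynomial (Fin r) R} (hNN : N * N = 0) (hNSN : N * S * N = N)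
    (hg : ∀ i, pderiv i g = dA N f i) (i : Fin r) : dA N (dS S g) i = pderiv i g := by
  have hfun : (fun k => pderiv k g) = mv N (fun k => pderiv k f) := by
    ext1 k
    rw [hg, dA_eq_mv]
  have hNg : ∀ i, dA N g i = 0 := by
    intro i
    rw [dA_eq_mv, hfun, ← mv_mul, hNN, mv_zero_left]
  have h1 : ∀ k, pderiv k (dS S g) = mv S (fun l => pderiv l g) k
      + ∑ l, yS S l * pderiv l (pderiv k g) := by
    intro k
    simp only [dS, map_sum, pderiv_mul, pderiv_yS, Finset.sum_add_distrib, mv]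
    congr 1
    exact Finset.sum_congr rfl fun l _ => by rw [pderiv_comm']
  have h2 : dA N (dS S g) i = mv N (mv S (fun l => pderiv l g)) i +
      ∑ l, yS S l * pderiv l (dA N g i) := by
    simp only [dA, h1, mul_add, Finset.sum_add_distrib]
    congr 1
    simp only [Finset.mul_sum, map_sum, pderiv_C_mul]
    rw [Finset.sum_comm]
    exact Finset.sum_congr rfl fun l _ => Finset.sum_congr rfl fun k _ => by ring
  rw [h2, hNg]
  simp only [map_zero, mul_zero, Finset.sum_const_zero, add_zero]
  rw [hfun, ← mv_mul, ← mv_mul, hNSN, hg, dA_eq_mv]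

end Degenerate

section Main

variable {K : Type*} {r : ℕ}

lemma regular_of_idem [Field K] [CharZero K] {d : ℕ} (hd : 1 ≤ d)
    (f : MvPolynomial (Fin r) K) (hf : f.IsHomogeneous d)
    (hann : ∀ D : MvPolynomial (Fin r) K, D.IsHomogeneous 1 → contract D f = 0 → D = 0)
    {E : Matrix (Fin r) (Fin r) K} (hE : IsM f E) (hEE : E * E = E) (hE0 : E ≠ 0) (hE1 : E ≠ 1) :
    ∃ G : Set (MvPolynomial (Fin r) K), IsRegSplit d f G ∧ 2 ≤ G.ncard := by
  obtain ⟨g, hg, hgE⟩ := poincare hd hf hE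
  have hEg : ∀ i, dA E g i = pderiv i g := by
    intro i
    have hfun : (fun k => pderiv k g) = mv E (fun k => pderiv k f) := by
      ext1 k
      rw [hgE, dA_eq_mv]
    rw [hgE, dA_eq_mv, dA_eq_mv, hfun, ← mv_mul, hEE]
  have h := regSplit_of hd hg (hf.sub hg) ?_ ?_ E hEg ?_
  · rwa [add_sub_cancel] at h
  · rintro rfl
    apply hE0
    apply eq_zero_of_dA hann
    intro i
    rw [← hgE, map_zero]
  · intro h
    apply hE1
    rw [← sub_eq_zero]
    apply eq_zero_of_dA hann
    intro i
    have h1 := dA_smul_one (1 : K) f i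
    rw [one_smul, C_1, one_mul] at h1
    rw [dA_sub, ← hgE, h1, ← map_sub, ← neg_sub, h]
    simp
  · intro i
    rw [dA_sub_right, hEg, hgE, sub_self]

lemma degenerate_of_nilp [Field K] [CharZero K] {d : ℕ} (hd : 1 ≤ d)
    (f : MvPolynomial (Fin r) K) (hf : f.IsHomogeneous d)
    (hann : ∀ D : MvPolynomial (Fin r) K, D.IsHomogeneous 1 → contract D f = 0 → D = 0)
    {N : Matrix (Fin r) (Fin r) K} (hN : IsM f N) (hNN : N * N = 0) (hN0 : N ≠ 0) :
    ∃ n : ℕ, 1 ≤ n ∧ ∃ ft : MvPolynomial (Fin r) (MvPolynomial (Fin n) K),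
        ft.IsHomogeneous d ∧
        MvPolynomial.map (MvPolynomial.eval (0 : Fin n → K)) ft = f ∧
        ∃ G : Set (MvPolynomial (Fin r) (FractionRing (MvPolynomial (Fin n) K))),
          IsRegSplit d (MvPolynomial.map (algebraMap (MvPolynomial (Fin n) K)
            (FractionRing (MvPolynomial (Fin n) K))) ft) G ∧ 2 ≤ G.ncard := by
  obtain ⟨g, hg, hgN⟩ := poincare hd hf hN
  have hg0 : g ≠ 0 := by
    rintro rfl
    apply hN0
    apply eq_zero_of_dA hann
    intro i
    rw [← hgN, map_zero]
  obtain ⟨S, hS⟩ := exists_ginv N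
  refine ⟨1, le_rfl, ?_⟩
  let t : MvPolynomial (Fin 1) K := X 0
  have ht : t ≠ 0 := X_ne_zero 0
  let cB : K →+* MvPolynomial (Fin 1) K := C
  let ev : MvPolynomial (Fin 1) K →+* K := eval (0 : Fin 1 → K)
  have hevc : ev.comp cB = RingHom.id K := by
    ext x
    simp [ev, cB]
  have hevt : ev t = 0 := by simp [ev, t]
  have hmm : ∀ p : MvPolynomial (Fin r) K, map ev (map cB p) = p := by
    intro p
    rw [map_map, hevc, map_id]
  obtain ⟨q, hq⟩ := taylor t (S.map cB) (map cB g)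
  have hfB : (map cB f).IsHomogeneous d := hf.map cB
  have hgB : (map cB g).IsHomogeneous d := hg.map cB
  have hqh : q.IsHomogeneous d := by
    have h1 : (C t * (C t * q)).IsHomogeneous d := by
      have : C t * (C t * q) = sb t (S.map cB) (map cB g) - map cB g
          - C t * dS (S.map cB) (map cB g) := by
        rw [hq]; ring
      rw [this]
      exact ((sb_hom t _ hgB).sub hgB).sub (C_mul_hom t (dS_hom _ hd hgB))
    intro m hm
    apply h1
    rw [coeff_C_mul, coeff_C_mul]
    exact mul_ne_zero ht (mul_ne_zero ht hm)
  refine ⟨map cB f + C t * q, hfB.add (C_mul_hom t hqh), ?_, ?_⟩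
  · change map ev _ = f
    rw [map_add, map_mul, map_C, hevt, hmm, C_0, zero_mul, add_zero]
  · let ι := algebraMap (MvPolynomial (Fin 1) K) (FractionRing (MvPolynomial (Fin 1) K))
    have hι : Function.Injective ι := IsFractionRing.injective _ _
    let a : K →+* FractionRing (MvPolynomial (Fin 1) K) := ι.comp cB
    have : CharZero (FractionRing (MvPolynomial (Fin 1) K)) := charZero_of_injective_ringHom
      (RingHom.injective a)
    have hτ : ι t ≠ 0 := by
      rw [Ne, map_eq_zero_iff ι hι]
      exact ht
    have hια : ∀ p : MvPolynomial (Fin r) K, map ι (map cB p) = map a p := by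
      intro p
      rw [map_map]
    set τ := ι t with hτdef
    set fL := map a f
    set gL := map a g
    set SL := S.map a
    set NL := N.map a
    have hNNL : NL * NL = 0 := by
      change N.map a * N.map a = 0
      rw [← Matrix.map_mul, hNN]
      simp
    have hNSNL : NL * SL * NL = NL := by
      change N.map a * S.map a * N.map a = N.map a
      rw [← Matrix.map_mul, ← Matrix.map_mul, hS]
    have hgNL : ∀ i, pderiv i gL = dA NL fL i := by
      intro i
      rw [dA_map, pderiv_map, hgN]
    have hfL : fL.IsHomogeneous d := hf.map a
    have hgL : gL.IsHomogeneous d := hg.map a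
    have hSS : (S.map cB).map ι = SL := by
      ext i j
      rfl
    let p := sb τ SL gL
    have hpmap : map ι (sb t (S.map cB) (map cB g)) = p := by
      rw [sb_map, hια, hSS]
    have hpq : p = gL + C τ * dS SL gL + C τ * (C τ * map ι q) := by
      rw [← hpmap, hq]
      simp only [map_add, map_mul, map_C, dS_map, hια, hSS]
      rfl
    have hp0 : p ≠ 0 := by
      rw [← hpmap]
      intro h
      apply hg0
      have h1 : sb t (S.map cB) (map cB g) = 0 := by
        apply map_injective ι hι
        rw [h, map_zero]
      have h2 := congrArg (map ev) h1
      rw [hq] at h2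
      simpa only [map_add, map_mul, map_C, hevt, C_0, zero_mul, add_zero, hmm, map_zero] using h2
    let g1 := C τ⁻¹ * p
    let h1 := fL - dS SL gL - C τ⁻¹ * gL
    have hsum : map ι (map cB f + C t * q) = g1 + h1 := by
      have hcc : (C τ⁻¹ : MvPolynomial (Fin r) (FractionRing (MvPolynomial (Fin 1) K))) * C τ
          = 1 := by
        rw [← C_mul, inv_mul_cancel₀ hτ, C_1]
      rw [map_add, map_mul, map_C, hια]
      change fL + C τ * map ι q = C τ⁻¹ * p + (fL - dS SL gL - C τ⁻¹ * gL)
      rw [hpq]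
      linear_combination (- dS SL gL - C τ * map ι q) * hcc
    change ∃ G : Set (MvPolynomial (Fin r) (FractionRing (MvPolynomial (Fin 1) K))),
          IsRegSplit d (map ι (map cB f + C t * q)) G ∧ 2 ≤ G.ncard
    rw [hsum]
    let Q := (1 + τ • SL) * NL
    have hQQ : Q * Q = τ • Q := by
      have e1 : NL * (1 + τ • SL) * NL = τ • NL := by
        rw [mul_add, add_mul, mul_one, hNNL, zero_add, mul_smul_comm, smul_mul_assoc, hNSNL]
      calc Q * Q = (1 + τ • SL) * (NL * (1 + τ • SL) * NL) := by simp only [Q, mul_assoc]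
        _ = τ • Q := by rw [e1, mul_smul_comm]
    have hEQ : (τ⁻¹ • Q) * Q = Q := by
      rw [smul_mul_assoc, hQQ, smul_smul, inv_mul_cancel₀ hτ, one_smul]
    have hpder : (fun k => pderiv k p) = mv Q (fun m => sb τ SL (pderiv m fL)) := by
      ext1 k
      rw [pderiv_sb, mv_mul]
      congr 1
      ext1 l
      rw [hgNL, dA, map_sum, mv]
      refine Finset.sum_congr rfl fun m _ => ?_
      rw [map_mul]
      congr 1
      simp [sb]
    have hEp : ∀ i, dA (τ⁻¹ • Q) p i = pderiv i p := by
      intro i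
      rw [dA_eq_mv, hpder, ← mv_mul, hEQ, ← hpder]
    have hNh : ∀ i, dA NL h1 i = 0 := by
      intro i
      have e1 : dA NL gL i = 0 := by
        have hfun : (fun k => pderiv k gL) = mv NL (fun k => pderiv k fL) := by
          ext1 k
          rw [hgNL, dA_eq_mv]
        rw [dA_eq_mv, hfun, ← mv_mul, hNNL, mv_zero_left]
      have e2 : dA NL (C τ⁻¹ * gL) i = C τ⁻¹ * dA NL gL i := by
        simp only [dA, pderiv_C_mul, Finset.mul_sum]
        exact Finset.sum_congr rfl fun k _ => by ring
      rw [dA_sub_right, dA_sub_right, dA_dS hNNL hNSNL hgNL, e2, e1, hgNL, sub_self, mul_zero,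
        sub_zero]
    refine regSplit_of hd (C_mul_hom _ (sb_hom τ SL hgL))
      ((hfL.sub (dS_hom SL hd hgL)).sub (C_mul_hom _ hgL)) ?_ ?_ (τ⁻¹ • Q) ?_ ?_
    · exact mul_ne_zero (by simpa using hτ) hp0
    · intro h
      apply hg0
      have e1 : map ι (C t * (map cB f - dS (S.map cB) (map cB g)) - map cB g) = 0 := by
        simp only [map_sub, map_mul, map_C, dS_map, hια, hSS]
        change C τ * (fL - dS SL gL) - gL = 0
        have hcc : (C τ : MvPolynomial (Fin r) (FractionRing (MvPolynomial (Fin 1) K))) * C τ⁻¹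
            = 1 := by
          rw [← C_mul, mul_inv_cancel₀ hτ, C_1]
        linear_combination C τ * h + gL * hcc
      have e2 : C t * (map cB f - dS (S.map cB) (map cB g)) - map cB g = 0 := by
        apply map_injective ι hι
        rw [e1, map_zero]
      have e3 := congrArg (map ev) e2
      simpa only [map_sub, map_mul, map_C, hevt, C_0, zero_mul, zero_sub, hmm, map_zero,
        neg_eq_zero] using e3
    · intro i
      have e2 : dA (τ⁻¹ • Q) (C τ⁻¹ * p) i = C τ⁻¹ * dA (τ⁻¹ • Q) p i := by
        simp only [dA, pderiv_C_mul, Finset.mul_sum]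
        exact Finset.sum_congr rfl fun k _ => by ring
      rw [e2, hEp, pderiv_C_mul]
    · intro i
      have e3 : τ⁻¹ • Q = (τ⁻¹ • (1 + τ • SL)) * NL := by rw [smul_mul_assoc]
      have e4 : mv NL (fun k => pderiv k h1) = fun _ => 0 := by
        ext1 k
        rw [← dA_eq_mv, hNh]
      change dA (τ⁻¹ • Q) h1 i = 0
      rw [e3, dA_eq_mv, mv_mul, e4, mv_zero_right]

end Main

/-- Corollary 4.6. Let `K` be algebraically closed, `d ≥ 3`, and
`f ∈ ℛ_d` with `ann_R(f)_1 = 0`. Then `f` has a regular splitting of length `≥ 2` or a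
degenerate splitting iff `ann_R f` has a minimal generator of degree `d`, i.e.
`ann_R(f)_d ≠ R_1·ann_R(f)_{d−1}`. -/
theorem splitting_iff_generator_in_socle_degree {K : Type*} [Field K] [CharZero K]
    [IsAlgClosed K] {r d : ℕ} (hd : 3 ≤ d)
    (f : MvPolynomial (Fin r) K) (hf : f.IsHomogeneous d)
    (hann : ∀ D : MvPolynomial (Fin r) K, D.IsHomogeneous 1 → contract D f = 0 → D = 0) :
    ((∃ G : Set (MvPolynomial (Fin r) K), IsRegSplit d f G ∧ 2 ≤ G.ncard) ∨
      (∃ n : ℕ, 1 ≤ n ∧ ∃ ft : MvPolynomial (Fin r) (MvPolynomial (Fin n) K),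
        ft.IsHomogeneous d ∧
        MvPolynomial.map (MvPolynomial.eval (0 : Fin n → K)) ft = f ∧
        ∃ G : Set (MvPolynomial (Fin r) (FractionRing (MvPolynomial (Fin n) K))),
          IsRegSplit d (MvPolynomial.map (algebraMap (MvPolynomial (Fin n) K)
            (FractionRing (MvPolynomial (Fin n) K))) ft) G ∧ 2 ≤ G.ncard)) ↔
    ∃ D : MvPolynomial (Fin r) K, D.IsHomogeneous d ∧ contract D f = 0 ∧
      D ∉ Submodule.span K {p : MvPolynomial (Fin r) K |
        ∃ i, ∃ E : MvPolynomial (Fin r) K,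
          E.IsHomogeneous (d - 1) ∧ contract E f = 0 ∧ p = X i * E} := by
  constructor
  · rintro (⟨G, hG, hc⟩ | ⟨n, -, ft, -, hft0, G, hG, hc⟩)
    · obtain ⟨A, hA, hns⟩ := exists_isM_of_split (by omega) hG hc
      exact generator_of_isM (by omega) f hf hann hA hns
    · have : CharZero (FractionRing (MvPolynomial (Fin n) K)) := charZero_of_injective_ringHom
        (RingHom.injective ((algebraMap (MvPolynomial (Fin n) K)
          (FractionRing (MvPolynomial (Fin n) K))).comp C))
      obtain ⟨A, hA, hns⟩ := exists_isM_of_split (by omega) hG hc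
      obtain ⟨A0, hA0, hns0⟩ := specialize_isM ft hA hns
      rw [hft0] at hA0
      exact generator_of_isM (by omega) f hf hann hA0 hns0
  · rintro ⟨D, hD, hDf, hDS⟩
    obtain ⟨A, hA, hns⟩ := isM_of_generator (by omega) f hf hD hDf hDS
    rcases dichotomy A hns with ⟨p, h1, h2, h3⟩ | ⟨p, h1, h2⟩
    · exact Or.inl (regular_of_idem (by omega) f hf hann (isM_aeval hA p) h1 h2 h3)
    · exact Or.inr (degenerate_of_nilp (by omega) f hf hann (isM_aeval hA p) h1 h2)

end Kleppe
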